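/- arXiv:1510.03287 — 2 statements merged into one kernel-verified Lean document; each statement's English description precedes it below -/
import Mathlib

section
/- Let κ be a measurable cardinal and U a normal κ-complete nonprincipal ultrafilter on κ. If 2^κ > κ⁺, then the set {α < κ : α is an infinite cardinal and 2^α > α⁺} belongs to U. -/
/-- A condition of Prikry forcing on `κ`: a finite set `s` of ordinals together
with a set `A` of ordinals (intended to be a member of the ultrafilter `U`). -/
structure PCond : Type 1 where
  s : Finset Ordinal.{0}
  A : Set Ordinal.{0}

/-- `U` is an ultrafilter on (the subsets of) `Set.Iio κ.ord`, i.e. on κ. -/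
def IsUltrafilterOn (κ : Cardinal.{0}) (U : Set (Set Ordinal.{0})) : Prop :=
  (∀ A ∈ U, A ⊆ Set.Iio κ.ord) ∧
  Set.Iio κ.ord ∈ U ∧
  (∅ : Set Ordinal.{0}) ∉ U ∧
  (∀ A B : Set Ordinal.{0}, A ∈ U → A ⊆ B → B ⊆ Set.Iio κ.ord → B ∈ U) ∧
  (∀ A B : Set Ordinal.{0}, A ∈ U → B ∈ U → A ∩ B ∈ U) ∧
  (∀ A : Set Ordinal.{0}, A ⊆ Set.Iio κ.ord → A ∈ U ∨ Set.Iio κ.ord \ A ∈ U)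

/-- `U` is κ-complete: the intersection of fewer than κ members of `U`
(here: a family indexed by an ordinal `γ < κ`) is in `U`. -/
def IsKappaComplete (κ : Cardinal.{0}) (U : Set (Set Ordinal.{0})) : Prop :=
  ∀ γ < κ.ord, ∀ f : Ordinal.{0} → Set Ordinal.{0},
    (∀ i < γ, f i ∈ U) → (Set.Iio κ.ord ∩ ⋂ i ∈ Set.Iio γ, f i) ∈ U

/-- `U` is normal: every function `f` with `f α < α` for all `α` in some set in `U`
is constant on a set in `U`. -/
def IsNormalOn (κ : Cardinal.{0}) (U : Set (Set Ordinal.{0})) : Prop :=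
  ∀ f : Ordinal.{0} → Ordinal.{0}, (∃ A ∈ U, ∀ α ∈ A, f α < α) →
    ∃ c : Ordinal.{0}, {α : Ordinal.{0} | α < κ.ord ∧ f α = c} ∈ U

/-- `U` is nonprincipal: it contains no singleton. -/
def IsNonprincipal (U : Set (Set Ordinal.{0})) : Prop := ∀ x : Ordinal.{0}, {x} ∉ U

/-- `p` is a condition of the Prikry forcing on `κ` with ultrafilter `U`:
`p = (s, A)` with `s` a finite subset of κ, `A ∈ U`, and every element of `s`
smaller than every element of `A`. -/
def PIsCond (κ : Cardinal.{0}) (U : Set (Set Ordinal.{0})) (p : PCond) : Prop :=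
  (↑p.s : Set Ordinal.{0}) ⊆ Set.Iio κ.ord ∧ p.A ∈ U ∧
  ∀ x ∈ p.s, ∀ a ∈ p.A, x < a

/-- `q ≤ p`: `q` extends `p`. -/
def PExt (q p : PCond) : Prop :=
  p.s ⊆ q.s ∧ q.A ⊆ p.A ∧ ∀ x ∈ q.s, x ∉ p.s → x ∈ p.A

/-- `q ≤* p`: `q` is a direct extension of `p`. -/
def PDirExt (q p : PCond) : Prop := PExt q p ∧ q.s = p.s

/-- `D` is a dense open subset of the Prikry forcing. -/
def PDenseOpen (κ : Cardinal.{0}) (U : Set (Set Ordinal.{0})) (D : Set PCond) : Prop :=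
  (∀ p ∈ D, PIsCond κ U p) ∧
  (∀ p, PIsCond κ U p → ∃ q ∈ D, PExt q p) ∧
  (∀ p ∈ D, ∀ q, PIsCond κ U q → PExt q p → q ∈ D)

open Cardinal Filter in
theorem aux_emb {T : Type} {α : Ordinal.{0}} (h : #T ≤ α.card) :
    ∃ f : T → Ordinal.{0}, Function.Injective f ∧ ∀ t, f t < α := by
  rw [← Cardinal.mk_toType] at h
  obtain ⟨e⟩ := h
  refine ⟨fun t => (Ordinal.ToType.mk.symm (e t)).1, ?_, fun t => (Ordinal.ToType.mk.symm (e t)).2⟩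
  intro a b hab
  exact e.injective (Ordinal.ToType.mk.symm.injective (Subtype.ext hab))

open Cardinal Filter in
theorem aux_card {T : Type} {α : Ordinal.{0}} (f : T → Ordinal.{0}) (hf : Function.Injective f)
    (hlt : ∀ t, f t < α) : #T ≤ α.card := by
  rw [← Cardinal.mk_toType]
  refine Cardinal.mk_le_of_injective (f := fun t => Ordinal.ToType.mk ⟨f t, hlt t⟩) ?_
  intro a b hab
  have := Ordinal.ToType.mk.injective hab
  exact hf (congrArg Subtype.val this)

open Cardinal Filter in
/-- A type of size at most `succ c` has a total relation with small initial segments. -/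
theorem aux_rel {T : Type} {α : Ordinal.{0}} (hinf : ℵ₀ ≤ α.card) (h : #T ≤ Order.succ α.card) :
    ∃ (r : T → T → Prop) (i : T → T → Ordinal.{0}), (∀ a b, r a b ∨ r b a) ∧
      (∀ a b, r a b → i b a < α) ∧ ∀ a a' b, r a b → r a' b → i b a = i b a' → a = a' := by
  classical
  obtain ⟨f, hf, hlt⟩ := aux_emb (T := T) (α := (Order.succ α.card).ord) (by simpa using h)
  have key : ∀ b : T, ∃ j : {a // f a ≤ f b} → Ordinal.{0}, Function.Injective j ∧
      ∀ t, j t < α := by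
    intro b
    apply aux_emb
    have h1 : #{a // f a ≤ f b} ≤ (Order.succ (f b)).card :=
      aux_card (fun a => f a.1) (fun a a' h => Subtype.ext (hf h)) (fun a => Order.lt_succ_of_le a.2)
    refine h1.trans ?_
    have h2 : (f b).card ≤ α.card := by
      have := hlt b
      rw [Cardinal.lt_ord] at this
      exact Order.lt_succ_iff.1 this
    rw [← Ordinal.add_one_eq_succ, Ordinal.card_add, Ordinal.card_one]
    exact Cardinal.add_le_of_le hinf h2 (Cardinal.one_le_aleph0.trans hinf)
  choose j hj hjlt using key
  refine ⟨fun a b => f a ≤ f b, fun b a => if h : f a ≤ f b then j b ⟨a, h⟩ else 0, ?_, ?_, ?_⟩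
  · intro a b; exact le_total _ _
  · intro a b h
    simp only [h, dif_pos]
    exact hjlt _ _
  · intro a a' b h h' heq
    simp only [h, h', dif_pos] at heq
    exact congrArg Subtype.val (hj b heq)

open Cardinal in
theorem aux_union {T : Type} {κ : Cardinal.{0}} (hκ : ℵ₀ < κ) (I : T → Set T) (S : Set T)
    (hS : #S = Order.succ κ) (hI : ∀ Y, #(I Y) ≤ κ) :
    #(⋃ Y ∈ S, I Y : Set T) ≤ Order.succ κ := by
  have h1 := Cardinal.mk_biUnion_le I S
  have h3 : (⨆ x : S, #(I x.1)) ≤ Order.succ κ :=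
    (ciSup_le' fun Y : S => hI Y.1).trans (Order.le_succ κ)
  have h4 : ℵ₀ ≤ Order.succ κ := hκ.le.trans (Order.le_succ κ)
  calc _ ≤ _ := h1
    _ ≤ Order.succ κ * Order.succ κ := by rw [hS]; gcongr
    _ = Order.succ κ := Cardinal.mul_eq_self h4

open Cardinal Filter in
theorem aux_main (κ : Cardinal.{0}) (hκ : ℵ₀ < κ) (F : Filter Ordinal.{0})
    (hne : F.NeBot)
    (hult : ∀ p : Ordinal.{0} → Prop, (∀ᶠ α in F, p α) ∨ ∀ᶠ α in F, ¬ p α)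
    (hunb : ∀ β < κ.ord, ∀ᶠ α in F, β < α)
    (hnorm : ∀ f : Ordinal.{0} → Ordinal.{0}, (∀ᶠ α in F, f α < α) →
      ∃ c < κ.ord, ∀ᶠ α in F, f α = c)
    (h2 : Order.succ κ < 2 ^ κ) :
    ∀ᶠ α in F, α.card.ord = α ∧ ℵ₀ ≤ α.card ∧ Order.succ α.card < 2 ^ α.card := by
  classical
  obtain ⟨k, hk, hklt⟩ := aux_emb (T := κ.ord.ToType) (α := κ.ord) (by simp)
  have hinf : ∀ᶠ α in F, ℵ₀ ≤ α.card := by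
    filter_upwards [hunb Ordinal.omega0 (by rw [Cardinal.lt_ord]; simpa using hκ)] with α hα
    have := Ordinal.card_le_card hα.le
    simpa using this
  have hcard : ∀ᶠ α in F, α.card.ord = α := by
    rcases hult (fun α => α.card.ord = α) with h | h
    · exact h
    exfalso
    obtain ⟨c, hc, hcF⟩ := hnorm (fun α => α.card.ord)
      (h.mono fun α hα => lt_of_le_of_ne (Cardinal.ord_card_le α) hα)
    have key : ∀ α : Ordinal.{0}, ∃ φ : α.ToType → Ordinal.{0}, Function.Injective φ ∧
        ∀ t, φ t < α.card.ord := fun α => aux_emb (by simp)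
    choose φ hφ hφlt using key
    let ψ : Ordinal.{0} → Ordinal.{0} → Ordinal.{0} := fun α β =>
      if h : β < α then φ α (Ordinal.ToType.mk ⟨β, h⟩) else 0
    have hψ : ∀ x : κ.ord.ToType, ∃ d, ∀ᶠ α in F, ψ α (k x) = d := by
      intro x
      obtain ⟨d, -, hd⟩ := hnorm (fun α => ψ α (k x)) (by
        filter_upwards [hunb _ (hklt x)] with α hα
        simp only [ψ, hα, dif_pos]
        exact (hφlt _ _).trans_le (Cardinal.ord_card_le α))
      exact ⟨d, hd⟩
    choose d hd using hψ
    have hle : #κ.ord.ToType ≤ c.card := by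
      refine aux_card d ?_ ?_
      · intro x y hxy
        obtain ⟨α, h1, h2, h3, h4⟩ := ((hd x).and ((hd y).and
          ((hunb _ (hklt x)).and (hunb _ (hklt y))))).exists
        rw [hxy, ← h2] at h1
        simp only [ψ, h3, h4, dif_pos] at h1
        have := Ordinal.ToType.mk.injective (hφ _ h1)
        exact hk (congrArg Subtype.val this)
      · intro x
        obtain ⟨α, h1, h2, h3⟩ := ((hd x).and ((hunb _ (hklt x)).and hcF)).exists
        rw [← h1, ← h3]
        simp only [ψ, h2, dif_pos]
        exact hφlt _ _
    rw [Cardinal.lt_ord] at hc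
    simp only [Cardinal.mk_toType, Cardinal.card_ord] at hle
    exact absurd hc (not_lt.2 hle)
  rcases hult (fun α => Order.succ α.card < 2 ^ α.card) with h | h
  · filter_upwards [hcard, hinf, h] with α h1 h2 h3 using ⟨h1, h2, h3⟩
  exfalso
  have key : ∀ α : Ordinal.{0}, ∃ (r : Set α.ToType → Set α.ToType → Prop)
      (i : Set α.ToType → Set α.ToType → Ordinal.{0}),
      (ℵ₀ ≤ α.card ∧ ¬ Order.succ α.card < 2 ^ α.card) → (∀ a b, r a b ∨ r b a) ∧
      (∀ a b, r a b → i b a < α) ∧ ∀ a a' b, r a b → r a' b → i b a = i b a' → a = a' := by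
    intro α
    by_cases hα : ℵ₀ ≤ α.card ∧ ¬ Order.succ α.card < 2 ^ α.card
    · obtain ⟨r, i, hri⟩ := aux_rel (T := Set α.ToType) hα.1 (by
        rw [Cardinal.mk_set, Cardinal.mk_toType]; exact not_lt.1 hα.2)
      exact ⟨r, i, fun _ => hri⟩
    · exact ⟨fun _ _ => True, fun _ _ => 0, fun h => absurd h hα⟩
  choose r i hri using key
  have hgood := hinf.and h
  let t : Set κ.ord.ToType → (α : Ordinal.{0}) → Set α.ToType := fun X α =>
    {x | (Ordinal.ToType.mk.symm x).1 ∈ k '' X}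
  have ht : ∀ X Y, (∀ᶠ α in F, t X α = t Y α) → X = Y := by
    intro X Y hXY
    ext x
    obtain ⟨α, h1, h2⟩ := (hXY.and (hunb _ (hklt x))).exists
    have h3 : Ordinal.ToType.mk ⟨k x, h2⟩ ∈ t X α ↔ Ordinal.ToType.mk ⟨k x, h2⟩ ∈ t Y α := by
      rw [h1]
    simpa [t, hk.eq_iff] using h3
  let I : Set κ.ord.ToType → Set (Set κ.ord.ToType) := fun Y =>
    {X | ∀ᶠ α in F, r α (t X α) (t Y α)}
  have htot : ∀ X Y, X ∈ I Y ∨ Y ∈ I X := by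
    intro X Y
    rcases hult (fun α => r α (t X α) (t Y α)) with h | h
    · exact Or.inl h
    · right
      filter_upwards [h, hgood] with α h1 h2
      exact ((hri α h2).1 _ _).resolve_left h1
  have hI : ∀ Y, #(I Y) ≤ κ := by
    intro Y
    have hc : ∀ X : I Y, ∃ c < κ.ord, ∀ᶠ α in F, i α (t Y α) (t X.1 α) = c := by
      intro X
      apply hnorm
      filter_upwards [X.2, hgood] with α h1 h2
      exact (hri α h2).2.1 _ _ h1
    choose c hclt hc using hc
    have := aux_card c (α := κ.ord) (fun X X' hXX => by
      apply Subtype.ext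
      apply ht
      filter_upwards [X.2, X'.2, hc X, hc X', hgood] with α h1 h2 h3 h4 h5
      exact (hri α h5).2.2 _ _ _ h1 h2 (by rw [h3, h4, hXX])) hclt
    simpa using this
  have hP : #(Set κ.ord.ToType) = 2 ^ κ := by simp
  obtain ⟨S, hS⟩ := Cardinal.le_mk_iff_exists_set.1 (h2.le.trans hP.ge)
  have hUn : #(⋃ Y ∈ S, I Y : Set (Set κ.ord.ToType)) ≤ Order.succ κ := by
    exact aux_union hκ I S hS hI
  have : ∃ X, X ∉ ⋃ Y ∈ S, I Y := by
    by_contra! hall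
    have : (⋃ Y ∈ S, I Y) = Set.univ := Set.eq_univ_of_forall hall
    rw [this, Cardinal.mk_univ, hP] at hUn
    exact absurd h2 (not_lt.2 hUn)
  obtain ⟨X, hX⟩ := this
  have hsub : S ⊆ I X := by
    intro Y hY
    refine (htot Y X).resolve_right fun hXY => hX ?_
    exact Set.mem_biUnion hY hXY
  have := (Cardinal.mk_le_mk_of_subset hsub).trans (hI X)
  rw [hS] at this
  exact absurd (Order.lt_succ κ) (not_lt.2 this)

/-- Scott: if `κ` carries a normal κ-complete nonprincipal
ultrafilter `U` and `2 ^ κ > κ⁺`, then the set of `α < κ` that are infinite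
cardinals with `2 ^ α > α⁺` belongs to `U`. (An ordinal `α` "is a cardinal"
when `α.card.ord = α`.) -/
theorem scott_gch_reflection (κ : Cardinal.{0}) (U : Set (Set Ordinal.{0}))
    (hκ : Cardinal.aleph0 < κ)
    (hU : IsUltrafilterOn κ U) (hcomp : IsKappaComplete κ U)
    (hnorm : IsNormalOn κ U) (hnp : IsNonprincipal U)
    (h2 : Order.succ κ < 2 ^ κ) :
    {α : Ordinal.{0} | α < κ.ord ∧ α.card.ord = α ∧ Cardinal.aleph0 ≤ α.card ∧
      Order.succ α.card < 2 ^ α.card} ∈ U := by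
  obtain ⟨hsub, huniv, hemp, hup, hint, hem⟩ := hU
  let F : Filter Ordinal.{0} :=
    { sets := {S | S ∩ Set.Iio κ.ord ∈ U}
      univ_sets := by simpa using huniv
      sets_of_superset := fun {x y} hx hxy =>
        hup _ _ hx (Set.inter_subset_inter_left _ hxy) Set.inter_subset_right
      inter_sets := fun {x y} hx hy => by
        have := hint _ _ hx hy
        rwa [← Set.inter_inter_distrib_right] at this }
  have hF : ∀ S, S ∈ F ↔ S ∩ Set.Iio κ.ord ∈ U := fun S => Iff.rfl
  have hne : F.NeBot := by
    refine ⟨fun h => hemp ?_⟩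
    have : (∅ : Set Ordinal.{0}) ∈ F := by rw [h]; exact Filter.mem_bot
    simpa [hF] using this
  have hunb : ∀ β < κ.ord, ∀ᶠ α in F, β < α := by
    intro β hβ
    have hlim : Order.succ β < κ.ord :=
      (Cardinal.isSuccLimit_ord hκ.le).succ_lt hβ
    have := hcomp _ hlim (fun i => Set.Iio κ.ord \ {i}) (fun i hi => by
      refine (hem {i} ?_).resolve_left (hnp i)
      rintro _ rfl
      exact lt_trans hi hlim)
    refine hup _ _ this ?_ Set.inter_subset_right
    rintro α ⟨h1, h2⟩
    refine ⟨?_, h1⟩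
    by_contra hle
    have h3 : α < Order.succ β := Order.lt_succ_of_le (not_lt.1 hle)
    have := Set.mem_iInter₂.1 h2 α h3
    exact this.2 rfl
  have := aux_main κ hκ F hne ?_ hunb ?_ h2
  · have h := (hF _).1 this
    refine hup _ _ h ?_ (fun α hα => hα.1)
    rintro α ⟨h1, h2⟩
    exact ⟨h2, h1⟩
  · intro p
    rcases hem ({α | p α} ∩ Set.Iio κ.ord) Set.inter_subset_right with h | h
    · exact Or.inl h
    · right
      refine hup _ _ h ?_ Set.inter_subset_right
      rintro α ⟨h1, h2⟩
      exact ⟨fun h => h2 ⟨h, h1⟩, h1⟩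
  · intro f hf
    obtain ⟨c, hc⟩ := hnorm f ⟨_, hf, fun α hα => hα.1⟩
    have hcF : ∀ᶠ α in F, f α = c := by
      refine hup _ _ hc ?_ Set.inter_subset_right
      rintro α ⟨h1, h2⟩
      exact ⟨h2, h1⟩
    refine ⟨c, ?_, hcF⟩
    have hlt : ∀ᶠ α in F, α < κ.ord := by
      change _ ∩ _ ∈ U
      simpa [Set.Iio] using huniv
    obtain ⟨α, h1, h2, h3⟩ := (hcF.and (hf.and hlt)).exists
    rw [← h1]
    exact h2.trans h3
end

section
/- Let κ be an inaccessible cardinal. Then the forcing Sacks(κ) is <κ-closed: for every ordinal α < κ and every ≤-decreasing sequence ⟨p_β : β < α⟩ of conditions in Sacks(κ), the intersection ⋂_{β<α} p_β is a condition in Sacks(κ) and is a lower bound of the sequence. -/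
/-- A binary sequence of transfinite length: `len` is its length and `ones` is
the set of positions (below `len`) at which the value is `1`. -/
structure BSeq : Type 1 where
  len : Ordinal.{0}
  ones : Set Ordinal.{0}

/-- `s` is a binary sequence of length `< κ`, i.e. an element of `2^{<κ}`. -/
def IsBSeq (κ : Cardinal.{0}) (s : BSeq) : Prop :=
  s.len < κ.ord ∧ s.ones ⊆ Set.Iio s.len

/-- `t` is an initial segment of `s`. -/
def BPrefix (t s : BSeq) : Prop :=
  t.len ≤ s.len ∧ t.ones = s.ones ∩ Set.Iio t.len

/-- `s⌢b`: the sequence `s` extended by one bit `b`. -/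
def BExtBit (s : BSeq) (b : Bool) : BSeq :=
  ⟨s.len + 1, if b then s.ones ∪ {s.len} else s.ones⟩

/-- The union `⋃_{β<α} s β` of a `⊆`-increasing sequence of binary sequences. -/
noncomputable def BUnion (s : Ordinal.{0} → BSeq) (α : Ordinal.{0}) : BSeq :=
  ⟨sSup ((fun β => (s β).len) '' Set.Iio α), ⋃ β ∈ Set.Iio α, (s β).ones⟩

/-- `C` is a club (closed unbounded) subset of `κ`. -/
def IsClubIn (κ : Cardinal.{0}) (C : Set Ordinal.{0}) : Prop :=
  C ⊆ Set.Iio κ.ord ∧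
  (∀ β < κ.ord, ∃ c ∈ C, β < c) ∧
  (∀ β : Ordinal.{0}, 0 < β → β < κ.ord →
    (∀ γ < β, ∃ c ∈ C, γ < c ∧ c < β) → β ∈ C)

/-- `p` is a condition of `Sacks(κ)`: a subset of `2^{<κ}` closed under initial
segments, each of whose elements has a proper extension in `p`, closed under
unions of `⊆`-increasing sequences of length `< κ`, and whose splitting nodes
are exactly the nodes whose length lies in some club `C(p) ⊆ κ`. -/
def IsSacksCond (κ : Cardinal.{0}) (p : Set BSeq) : Prop :=
  (∀ s ∈ p, IsBSeq κ s) ∧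
  (∀ s ∈ p, ∀ t : BSeq, BPrefix t s → t ∈ p) ∧
  (∀ s ∈ p, ∃ t ∈ p, BPrefix s t ∧ s.len < t.len) ∧
  (∀ α < κ.ord, ∀ s : Ordinal.{0} → BSeq,
    (∀ β < α, s β ∈ p) →
    (∀ β γ, β ≤ γ → γ < α → BPrefix (s β) (s γ)) →
    BUnion s α ∈ p) ∧
  (∃ C : Set Ordinal.{0}, IsClubIn κ C ∧
    {s ∈ p | BExtBit s false ∈ p ∧ BExtBit s true ∈ p} = {s ∈ p | s.len ∈ C})

theorem sk_step (κ : Cardinal.{0}) (hκ : κ.IsInaccessible)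
    (α : Ordinal.{0}) (hα : α < κ.ord) (C : Ordinal.{0} → Set Ordinal.{0})
    (hC : ∀ β < α, IsClubIn κ (C β)) (γ : Ordinal.{0}) (hγ : γ < κ.ord) :
    ∃ δ < κ.ord, ∀ β < α, ∃ c ∈ C β, γ < c ∧ c < δ := by
  have h : ∀ β : Set.Iio α, ∃ c ∈ C β, γ < c := fun β => (hC β.1 β.2).2.1 γ hγ
  choose f hf hγf using h
  refine ⟨⨆ β, (f β + 1), ?_, ?_⟩
  · apply Ordinal.lift_iSup_add_one_lt_of_lt_cof
    · rw [← Ordinal.lift_cof, hκ.isRegular.cof_ord, Cardinal.mk_Iio_ordinal]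
      rw [Cardinal.lift_lift, Cardinal.lift_lt]
      exact Cardinal.lt_ord.1 hα
    · intro β
      exact (hC β.1 β.2).1 (hf β)
  · intro β hβ
    exact ⟨f ⟨β, hβ⟩, hf ⟨β, hβ⟩, hγf ⟨β, hβ⟩, Ordinal.lt_iSup_add_one (f := f) ⟨β, hβ⟩⟩

theorem sk_club (κ : Cardinal.{0}) (hκ : κ.IsInaccessible)
    (α : Ordinal.{0}) (hα0 : 0 < α) (hα : α < κ.ord) (C : Ordinal.{0} → Set Ordinal.{0})
    (hC : ∀ β < α, IsClubIn κ (C β)) : IsClubIn κ (⋂ β ∈ Set.Iio α, C β) := by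
  refine ⟨?_, ?_, ?_⟩
  · intro x hx
    simp only [Set.mem_iInter, Set.mem_Iio] at hx
    exact (hC 0 hα0).1 (hx 0 hα0)
  · intro γ hγ
    have h : ∀ x : Set.Iio κ.ord, ∃ δ : Set.Iio κ.ord,
        ∀ β < α, ∃ c ∈ C β, x.1 < c ∧ c < δ.1 := by
      intro x
      obtain ⟨δ, h1, h2⟩ := sk_step κ hκ α hα C hC x.1 x.2
      exact ⟨⟨δ, h1⟩, h2⟩
    choose g hg using h
    let d : ℕ → Set.Iio κ.ord := fun n => g^[n] ⟨γ, hγ⟩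
    have hd : ∀ n, ∀ β < α, ∃ c ∈ C β, (d n).1 < c ∧ c < (d (n+1)).1 := by
      intro n
      have : d (n+1) = g (d n) := Function.iterate_succ_apply' g n _
      rw [this]
      exact hg (d n)
    have hle : ∀ n, (d n).1 ≤ ⨆ n, (d n).1 := fun n =>
      Ordinal.le_iSup (fun n => (d n).1) n
    have hlt : γ < ⨆ n, (d n).1 := by
      obtain ⟨c, _, h1, h2⟩ := hd 0 0 hα0
      exact (h1.trans h2).trans_le (hle 1)
    refine ⟨⨆ n, (d n).1, ?_, hlt⟩
    simp only [Set.mem_iInter, Set.mem_Iio]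
    intro β hβ
    apply (hC β hβ).2.2 _ (pos_of_gt hlt)
    · apply Ordinal.lift_iSup_lt_of_lt_cof
      · rw [← Ordinal.lift_cof, hκ.isRegular.cof_ord]
        simpa using hκ.1
      · exact fun n => (d n).2
    · intro x hx
      obtain ⟨n, hn⟩ := Ordinal.lt_iSup_iff.1 hx
      obtain ⟨c, hc, h1, h2⟩ := hd n β hβ
      exact ⟨c, hc, hn.trans h1, h2.trans_le (hle _)⟩
  · intro β h0 hβ h
    simp only [Set.mem_iInter, Set.mem_Iio] at h ⊢
    intro i hi
    apply (hC i hi).2.2 β h0 hβ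
    intro γ hγ
    obtain ⟨c, hc, h⟩ := h γ hγ
    exact ⟨c, hc i hi, h⟩

theorem sk_ext (κ : Cardinal.{0}) (p : Set BSeq) (hp : IsSacksCond κ p) (s : BSeq) (hs : s ∈ p) :
    BExtBit s false ∈ p ∨ BExtBit s true ∈ p := by
  obtain ⟨t, ht, ⟨_, h2⟩, h3⟩ := hp.2.2.1 s hs
  by_cases h : s.len ∈ t.ones
  · right
    apply hp.2.1 t ht
    refine ⟨Order.add_one_le_of_lt h3, ?_⟩
    ext x
    simp only [BExtBit, if_true, h2, Set.mem_union, Set.mem_inter_iff, Set.mem_Iio,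
      Set.mem_singleton_iff, Order.lt_add_one_iff]
    constructor
    · rintro (⟨h, h'⟩ | rfl)
      · exact ⟨h, h'.le⟩
      · exact ⟨h, le_rfl⟩
    · rintro ⟨h, h'⟩
      rcases h'.lt_or_eq with h' | h'
      · exact Or.inl ⟨h, h'⟩
      · exact Or.inr h'
  · left
    apply hp.2.1 t ht
    refine ⟨Order.add_one_le_of_lt h3, ?_⟩
    ext x
    simp only [BExtBit, h2, Set.mem_inter_iff, Set.mem_Iio, Order.lt_add_one_iff,
      Bool.false_eq_true, if_false]
    constructor
    · rintro ⟨h, h'⟩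
      exact ⟨h, h'.le⟩
    · rintro ⟨h1, h'⟩
      refine ⟨h1, h'.lt_of_ne ?_⟩
      rintro rfl
      exact h h1

theorem sk_prefix (s : BSeq) (hs : s.ones ⊆ Set.Iio s.len) (b : Bool) :
    BPrefix s (BExtBit s b) ∧ s.len < (BExtBit s b).len := by
  have h : s.len < s.len + 1 := Order.lt_add_one_iff.2 le_rfl
  refine ⟨⟨h.le, ?_⟩, h⟩
  ext x
  have := @hs x
  cases b
  · simp only [BExtBit]
    simp only [Set.mem_Iio] at this
    simp
    exact this
  · simp only [BExtBit]
    simp only [Set.mem_Iio] at this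
    simp
    constructor
    · intro h
      exact ⟨Or.inr h, this h⟩
    · rintro ⟨rfl | h, h'⟩
      · exact absurd h' (lt_irrefl _)
      · exact h

/-- for κ inaccessible, `Sacks(κ)` (ordered by inclusion) is
`<κ`-closed: the intersection of a decreasing sequence of fewer than κ
conditions is a condition and a lower bound of the sequence. -/
theorem sacks_lt_kappa_closed (κ : Cardinal.{0}) (hκ : κ.IsInaccessible)
    (α : Ordinal.{0}) (hα0 : 0 < α) (hα : α < κ.ord)
    (p : Ordinal.{0} → Set BSeq)
    (hp : ∀ β < α, IsSacksCond κ (p β))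
    (hdec : ∀ β γ, β ≤ γ → γ < α → p γ ⊆ p β) :
    IsSacksCond κ (⋂ β ∈ Set.Iio α, p β) ∧
    ∀ β < α, (⋂ β' ∈ Set.Iio α, p β') ⊆ p β := by
  have mem : ∀ s, s ∈ (⋂ β ∈ Set.Iio α, p β) ↔ ∀ β < α, s ∈ p β := by
    intro s
    simp only [Set.mem_iInter, Set.mem_Iio]
  refine ⟨⟨?_, ?_, ?_, ?_, ?_⟩, fun β hβ s hs => (mem s).1 hs β hβ⟩
  · intro s hs
    exact (hp 0 hα0).1 s ((mem s).1 hs 0 hα0)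
  · intro s hs t ht
    rw [mem] at hs ⊢
    exact fun β hβ => (hp β hβ).2.1 s (hs β hβ) t ht
  · intro s hs
    rw [mem] at hs
    have hb := ((hp 0 hα0).1 s (hs 0 hα0)).2
    have key : ∃ b, ∀ β < α, BExtBit s b ∈ p β := by
      by_cases h : ∀ β < α, BExtBit s false ∈ p β
      · exact ⟨false, h⟩
      · push Not at h
        obtain ⟨β, hβ, h⟩ := h
        refine ⟨true, fun γ hγ => ?_⟩
        have hm : max β γ < α := max_lt hβ hγ
        rcases sk_ext κ _ (hp _ hm) s (hs _ hm) with h' | h'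
        · exact absurd (hdec β _ (le_max_left _ _) hm h') h
        · exact hdec γ _ (le_max_right _ _) hm h'
    obtain ⟨b, hb'⟩ := key
    exact ⟨BExtBit s b, (mem _).2 hb', sk_prefix s hb b⟩
  · intro a ha s hs hinc
    rw [mem]
    intro β hβ
    exact (hp β hβ).2.2.2.1 a ha s (fun i hi => (mem _).1 (hs i hi) β hβ) hinc
  · have h : ∀ β, ∃ C : Set Ordinal.{0}, β < α → IsClubIn κ C ∧
        {s ∈ p β | BExtBit s false ∈ p β ∧ BExtBit s true ∈ p β} = {s ∈ p β | s.len ∈ C} := by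
      intro β
      by_cases hβ : β < α
      · obtain ⟨C, hC⟩ := (hp β hβ).2.2.2.2
        exact ⟨C, fun _ => hC⟩
      · exact ⟨∅, fun h => absurd h hβ⟩
    choose C hC using h
    refine ⟨_, sk_club κ hκ α hα0 hα C fun β hβ => (hC β hβ).1, ?_⟩
    ext s
    simp only [Set.mem_sep_iff, mem]
    refine and_congr_right fun hs => ?_
    simp only [Set.mem_iInter, Set.mem_Iio]
    have e : ∀ β < α, (BExtBit s false ∈ p β ∧ BExtBit s true ∈ p β ↔ s.len ∈ C β) := by
      intro β hβ
      have := Set.ext_iff.1 (hC β hβ).2 s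
      simpa only [Set.mem_sep_iff, hs β hβ, true_and] using this
    constructor
    · rintro ⟨h1, h2⟩ β hβ
      exact (e β hβ).1 ⟨h1 β hβ, h2 β hβ⟩
    · intro h
      exact ⟨fun β hβ => ((e β hβ).2 (h β hβ)).1, fun β hβ => ((e β hβ).2 (h β hβ)).2⟩
end
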